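/- arXiv:math/0107144 — 2 statements merged into one kernel-verified Lean document; each statement's English description precedes it below -/
import Mathlib

section
/- (Conditional Bayes formula.) Let (Ω, 𝓕, P) be a probability space, let H_1,…,H_k be a finite partition of Ω with P(H_i) > 0 for all i, let P_j be the conditional probability measure P_j(F) = P(F ∩ H_j)/P(H_j), and let E_j denote conditional expectation with respect to P_j. Then for every sub-σ-algebra 𝓕⁰ of 𝓕, every P-integrable real random variable U and every index j, one has E[1_{H_j} U | 𝓕⁰] = E[1_{H_j} | 𝓕⁰] · E_j[U | 𝓕⁰] almost surely. -/
open MeasureTheory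

noncomputable section

/-- The conditional probability measure `P_j(F) = P(F ∩ H_j) / P(H_j)`. -/
def condMeasure {Ω : Type*} {mΩ : MeasurableSpace Ω} (μ : Measure Ω) (Hj : Set Ω) :
    Measure Ω :=
  (μ Hj)⁻¹ • μ.restrict Hj

theorem condMeasure_isProbabilityMeasure {Ω : Type*} {mΩ : MeasurableSpace Ω} (μ : Measure Ω)
    [IsFiniteMeasure μ] {A : Set Ω} (hA : μ A ≠ 0) : IsProbabilityMeasure (condMeasure μ A) :=
  ⟨by simp [condMeasure, ENNReal.inv_mul_cancel hA (measure_ne_top μ A)]⟩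

theorem smul_condMeasure {Ω : Type*} {mΩ : MeasurableSpace Ω} (μ : Measure Ω)
    [IsFiniteMeasure μ] {A : Set Ω} (hA : μ A ≠ 0) : μ A • condMeasure μ A = μ.restrict A := by
  rw [condMeasure, smul_smul, ENNReal.mul_inv_cancel hA (measure_ne_top μ A), one_smul]

theorem setIntegral_condExp_condMeasure {Ω : Type*} {m mΩ : MeasurableSpace Ω} (hm : m ≤ mΩ)
    (μ : Measure Ω) [IsFiniteMeasure μ] {A : Set Ω} (hA : μ A ≠ 0) {f : Ω → ℝ}
    (hf : Integrable f (condMeasure μ A)) {s : Set Ω} (hs : MeasurableSet[m] s) :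
    ∫ x in s, ((condMeasure μ A)[f | m]) x ∂μ.restrict A = ∫ x in s, f x ∂μ.restrict A := by
  have := condMeasure_isProbabilityMeasure μ hA
  rw [← smul_condMeasure μ hA, Measure.restrict_smul, integral_smul_measure,
    integral_smul_measure, setIntegral_condExp hm hf hs]

/-- **conditional Bayes formula.** Let `(Ω, 𝓕, P)` be a probability space,
`H_1, …, H_k` a finite partition of `Ω` with `P(H_i) > 0` for all `i`, and `P_j` the conditional
measure given `H_j`.  Then for every sub-σ-algebra `𝓕⁰`, every integrable `U` and every `j`,
`E[1_{H_j} U | 𝓕⁰] = E[1_{H_j} | 𝓕⁰] · E_j[U | 𝓕⁰]` a.s. -/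
theorem condexp_indicator_mul_eq_condexp_mul_condMeasure {Ω : Type*} {mΩ : MeasurableSpace Ω}
    (μ : Measure Ω) [IsProbabilityMeasure μ]
    (k : ℕ) (H : Fin k → Set Ω)
    (hHmeas : ∀ i, MeasurableSet (H i))
    (hHdisj : Pairwise (Function.onFun Disjoint H))
    (hHcover : ⋃ i, H i = Set.univ)
    (hHpos : ∀ i, 0 < μ (H i))
    (m' : MeasurableSpace Ω) (hm' : m' ≤ mΩ)
    (U : Ω → ℝ) (hU : Integrable U μ) (j : Fin k) :
    ∀ᵐ ω ∂μ,
      (μ[(H j).indicator U | m']) ω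
        = (μ[(H j).indicator (fun _ => (1 : ℝ)) | m']) ω
            * ((condMeasure μ (H j))[U | m']) ω := by
  have hA : μ (H j) ≠ 0 := (hHpos j).ne'
  have hUj : Integrable U (condMeasure μ (H j)) :=
    hU.restrict.smul_measure (ENNReal.inv_ne_top.2 hA)
  set V := (condMeasure μ (H j))[U | m']
  have hVint : Integrable ((H j).indicator V) μ := by
    rw [integrable_indicator_iff (hHmeas j), IntegrableOn, ← smul_condMeasure μ hA]
    exact integrable_condExp.smul_measure (measure_ne_top μ (H j))
  have hmul : (H j).indicator V = (H j).indicator (fun _ => (1 : ℝ)) * V := by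
    ext ω
    by_cases hω : ω ∈ H j <;> simp [hω]
  have hpull : μ[(H j).indicator V | m'] =ᵐ[μ] μ[(H j).indicator (fun _ => (1 : ℝ)) | m'] * V := by
    rw [hmul] at hVint ⊢
    exact condExp_mul_of_stronglyMeasurable_right stronglyMeasurable_condExp hVint
      ((integrable_const 1).indicator (hHmeas j))
  have hbayes : μ[(H j).indicator V | m'] =ᵐ[μ] μ[(H j).indicator U | m'] := by
    refine ae_eq_condExp_of_forall_setIntegral_eq hm' (hU.indicator (hHmeas j))
      (fun _ _ _ => integrable_condExp.integrableOn) (fun s hs _ => ?_)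
      stronglyMeasurable_condExp.aestronglyMeasurable
    rw [setIntegral_condExp hm' hVint hs, integral_indicator (hHmeas j),
      integral_indicator (hHmeas j), Measure.restrict_comm (hHmeas j)]
    exact setIntegral_condExp_condMeasure hm' μ hA hUj hs
  exact hbayes.symm.trans hpull
end
end

section
/- (Filter for Σ_S.) Let X = (X_t)_{t≥0} and Y = (Y_t)_{t≥0} be processes with values in the standard bases E of ℝ^n and F of ℝ^m respectively; set W_t = Y_{t−1} ⊗ X_t for t ≥ 1, 𝓖_t = σ(X_0,…,X_t, Y_0,…,Y_{t−1}), and 𝓕^Y_t = σ(Y_0,…,Y_t). Assume there is an (mn)×n matrix R̄, written in blocks R̄ = [R_1; … ; R_m] with each R_j ∈ ℝ^{n×n}, such that E[W_{t+1} | 𝓖_t] = R̄ X_t almost surely for all t ≥ 1 (and also for t = 0 with 𝓖_0 = σ(X_0), where W_1 = Y_0 ⊗ X_1). Define the predictor X̂_{t+1|t} = E[X_{t+1} | 𝓕^Y_t], the filter X̂_t = E[X_t | 𝓕^Y_t], X̂_{0|−1} = E[X_0], and G = (I_m ⊗ 1_n^T) R̄. Then: (i) for every t ≥ 0 and every j ∈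 {1,…,m}, almost surely on the event {Y_t = f_j} one has 1_n^T R_j X̂_{t|t−1} > 0 and X̂_{t+1|t} = R_j X̂_{t|t−1} / (1_n^T R_j X̂_{t|t−1}); (ii) E[Y_{t+1} | 𝓕^Y_t] = G X̂_{t+1|t} almost surely; (iii) for every t and j, almost surely on the event {Y_{t+1} = f_j} one has (G X̂_{t+1|t})_j > 0 and X̂_{t+1} = diag(X̂_{t+1|t}) G_{j·}^T / (G X̂_{t+1|t})_j, where G_{j·} is the j-th row of G. -/
open MeasureTheory Matrix ProbabilityTheory
open scoped Kronecker

noncomputable section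

/-- The `i`-th standard basis vector of `ℝ^n`. -/
def stdBasis (n : ℕ) (i : Fin n) : Fin n → ℝ := fun k => if k = i then 1 else 0

/-- The operator `Δ(G)`: the `(mn) × n` matrix obtained by stacking the diagonal matrices of
the rows of `G`; its `((j,i), k)` entry is `G j i` if `k = i` and `0` otherwise. -/
def deltaOp {m n : ℕ} (G : Matrix (Fin m) (Fin n) ℝ) :
    Matrix (Fin m × Fin n) (Fin n) ℝ :=
  Matrix.of fun p k => if k = p.2 then G p.1 p.2 else 0

/-- Kronecker product `y ⊗ x` of two vectors (indexed by `Fin m × Fin n`). -/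
def vecKron {m n : ℕ} (y : Fin m → ℝ) (x : Fin n → ℝ) : Fin m × Fin n → ℝ :=
  fun p => y p.1 * x p.2

/-- The matrix `1_m^T ⊗ I_n` (after the canonical identification `Fin 1 × Fin n ≃ Fin n`). -/
def onesKronId (m n : ℕ) : Matrix (Fin n) (Fin m × Fin n) ℝ :=
  ((Matrix.of fun (_ : Fin 1) (_ : Fin m) => (1 : ℝ)) ⊗ₖ (1 : Matrix (Fin n) (Fin n) ℝ)).submatrix
    (fun k => ((0 : Fin 1), k)) id

/-- The σ-algebra generated by `X_0, …, X_t`. -/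
def sigmaUpTo {Ω α : Type*} [MeasurableSpace α] (X : ℕ → Ω → α) (t : ℕ) :
    MeasurableSpace Ω :=
  ⨆ s ∈ Finset.Iic t, MeasurableSpace.comap (X s) inferInstance

/-- The σ-algebra `𝓕_t = σ(X_0,…,X_t, Y_0,…,Y_t)`. -/
def filtF {Ω : Type*} {n m : ℕ} (X : ℕ → Ω → Fin n → ℝ) (Y : ℕ → Ω → Fin m → ℝ) (t : ℕ) :
    MeasurableSpace Ω :=
  sigmaUpTo X t ⊔ sigmaUpTo Y t

/-- The σ-algebra `𝓖_t = σ(X_0,…,X_t, Y_0,…,Y_{t-1})` (so `𝓖_0 = σ(X_0)`). -/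
def filtG {Ω : Type*} {n m : ℕ} (X : ℕ → Ω → Fin n → ℝ) (Y : ℕ → Ω → Fin m → ℝ) :
    ℕ → MeasurableSpace Ω
  | 0 => sigmaUpTo X 0
  | (t + 1) => sigmaUpTo X (t + 1) ⊔ sigmaUpTo Y t

/-- The `j`-th `n × n` block `R_j` of an `(mn) × n` matrix `R̄ = [R_1; … ; R_m]`. -/
def block {m n : ℕ} (Rbar : Matrix (Fin m × Fin n) (Fin n) ℝ) (j : Fin m) :
    Matrix (Fin n) (Fin n) ℝ :=
  Matrix.of fun a b => Rbar (j, a) b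

/-- The matrix `I_m ⊗ 1_n^T` (after the canonical identification `Fin m × Fin 1 ≃ Fin m`). -/
def idKronOnesRow (m n : ℕ) : Matrix (Fin m) (Fin m × Fin n) ℝ :=
  ((1 : Matrix (Fin m) (Fin m) ℝ) ⊗ₖ (Matrix.of fun (_ : Fin 1) (_ : Fin n) => (1 : ℝ))).submatrix
    (fun j => (j, (0 : Fin 1))) id

/-- The predictor `X̂_{t|t-1} = E[X_t | 𝓕^Y_{t-1}]`, with `X̂_{0|-1} = E[X_0]`. -/
def predictor {Ω : Type*} {mΩ : MeasurableSpace Ω} {n m : ℕ} (μ : Measure Ω)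
    (X : ℕ → Ω → Fin n → ℝ) (Y : ℕ → Ω → Fin m → ℝ) : ℕ → Ω → Fin n → ℝ
  | 0 => fun _ k => ∫ ω, X 0 ω k ∂μ
  | (t + 1) => fun ω k => (μ[fun ω' => X (t + 1) ω' k | sigmaUpTo Y t]) ω

section Bayes

variable {Ω : Type*} {H K mΩ : MeasurableSpace Ω} {μ : Measure Ω} {S : Set Ω}

/-- Every `H ⊔ σ(Y)`-measurable set agrees on a level set of `Y` with an `H`-measurable set. -/
lemma exists_measurableSet_inter_level_eq {β : Type*} [MeasurableSpace β] (Y : Ω → β) (b : β)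
    {A : Set Ω} (hA : MeasurableSet[H ⊔ MeasurableSpace.comap Y inferInstance] A) :
    ∃ B, MeasurableSet[H] B ∧ A ∩ {ω | Y ω = b} = B ∩ {ω | Y ω = b} := by
  set S : Set Ω := {ω | Y ω = b}
  have hle : H ⊔ MeasurableSpace.comap Y inferInstance
      ≤ (H.comap (Subtype.val : S → Ω)).map Subtype.val := by
    refine sup_le (MeasurableSpace.le_map_comap) ?_
    rintro _ ⟨C, -, rfl⟩
    by_cases hb : b ∈ C
    · refine ⟨Set.univ, MeasurableSet.univ, ?_⟩
      ext ⟨ω, hω⟩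
      have : Y ω = b := hω
      simp [this, hb]
    · refine ⟨∅, @MeasurableSet.empty _ H, ?_⟩
      ext ⟨ω, hω⟩
      have : Y ω = b := hω
      simp [this, hb]
  obtain ⟨B, hB, hBA⟩ := hle A hA
  refine ⟨B, hB, ?_⟩
  rw [Set.inter_comm A, Set.inter_comm B]
  exact (Subtype.preimage_val_eq_preimage_val_iff _ _ _).1 hBA.symm

/-- The conditional probability of `S` is a.s. positive on `S`. -/
lemma ae_condExp_indicator_one_pos [IsFiniteMeasure μ] (hH : H ≤ mΩ) (hS : MeasurableSet S) :
    ∀ᵐ ω ∂μ, ω ∈ S → 0 < (μ[S.indicator (fun _ => (1 : ℝ)) | H]) ω := by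
  set V := μ[S.indicator (fun _ => (1 : ℝ)) | H]
  have hint : Integrable (S.indicator (fun _ => (1 : ℝ))) μ := (integrable_const 1).indicator hS
  have hVm : StronglyMeasurable[H] V := stronglyMeasurable_condExp
  have hB : MeasurableSet[H] {ω | V ω ≤ 0} := hVm.measurable measurableSet_Iic
  have h1 : ∫ ω in {ω | V ω ≤ 0}, V ω ∂μ = μ.real ({ω | V ω ≤ 0} ∩ S) := by
    refine (setIntegral_condExp hH hint hB).trans ?_
    rw [setIntegral_indicator hS]
    simp
  have h2 : ∫ ω in {ω | V ω ≤ 0}, V ω ∂μ ≤ 0 :=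
    setIntegral_nonpos (hH _ hB) fun ω hω => hω
  have h3 : μ ({ω | V ω ≤ 0} ∩ S) = 0 := by
    have : μ.real ({ω | V ω ≤ 0} ∩ S) = 0 := le_antisymm (h1 ▸ h2) measureReal_nonneg
    exact (measureReal_eq_zero_iff).1 this
  filter_upwards [measure_eq_zero_iff_ae_notMem.1 h3] with ω hω hωS
  by_contra hneg
  exact hω ⟨not_lt.1 hneg, hωS⟩

lemma setIntegral_indicator_eq_of_inter_eq {A B : Set Ω} (hS : MeasurableSet S)
    (hAB : A ∩ S = B ∩ S) (f : Ω → ℝ) :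
    ∫ ω in A, S.indicator f ω ∂μ = ∫ ω in B, S.indicator f ω ∂μ := by
  rw [setIntegral_indicator hS, setIntegral_indicator hS, hAB]

/-- **Conditional Bayes formula.** If `K` and `H` have the same trace on `S ∈ K`, then on `S`
the conditional expectation given `K` is computed by conditioning on `H` and `S`. -/
lemma ae_condExp_eq_div_of_trace_eq [IsFiniteMeasure μ] (hHK : H ≤ K) (hK : K ≤ mΩ)
    (hS : MeasurableSet[K] S)
    (htrace : ∀ A, MeasurableSet[K] A → ∃ B, MeasurableSet[H] B ∧ A ∩ S = B ∩ S)
    {Z : Ω → ℝ} (hZ : Integrable Z μ) :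
    ∀ᵐ ω ∂μ, ω ∈ S →
      (μ[Z | K]) ω = (μ[S.indicator Z | H]) ω / (μ[S.indicator (fun _ => (1 : ℝ)) | H]) ω := by
  have hH : H ≤ mΩ := hHK.trans hK
  have hS' : MeasurableSet S := hK _ hS
  have hpos := ae_condExp_indicator_one_pos (μ := μ) hH hS'
  set V := μ[S.indicator (fun _ => (1 : ℝ)) | H]
  set U := μ[S.indicator Z | H]
  have hint1 : Integrable (S.indicator (fun _ => (1 : ℝ))) μ := (integrable_const 1).indicator hS'
  have hVm : StronglyMeasurable[H] V := stronglyMeasurable_condExp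
  have hUm : StronglyMeasurable[H] U := stronglyMeasurable_condExp
  have hVb : ∀ᵐ ω ∂μ, ‖V ω‖ ≤ 1 := by
    refine ae_bdd_abs_condExp_of_ae_bdd_abs (R := 1) (Filter.Eventually.of_forall fun ω => ?_)
    by_cases h : ω ∈ S <;> simp [h]
  have hVZ : Integrable (V * Z) μ := hZ.bdd_mul (hVm.mono hH).aestronglyMeasurable hVb
  have hUi : Integrable U μ := integrable_condExp
  have hVSZ : S.indicator (V * Z) = V * S.indicator Z := by
    ext ω; by_cases h : ω ∈ S <;> simp [h]
  have hUS : S.indicator U = U * S.indicator (fun _ => (1 : ℝ)) := by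
    ext ω; by_cases h : ω ∈ S <;> simp [h]
  have hpullV : μ[V * S.indicator Z | H] =ᵐ[μ] V * U :=
    condExp_mul_of_stronglyMeasurable_left hVm (hVSZ ▸ hVZ.indicator hS') (hZ.indicator hS')
  have hpullU : μ[U * S.indicator (fun _ => (1 : ℝ)) | H] =ᵐ[μ] U * V :=
    condExp_mul_of_stronglyMeasurable_left hUm (hUS ▸ hUi.indicator hS') hint1
  have hUV : S.indicator U =ᵐ[μ] μ[S.indicator (V * Z) | K] := by
    refine ae_eq_condExp_of_forall_setIntegral_eq hK (hVZ.indicator hS')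
      (fun A _ _ => (hUi.indicator hS').integrableOn) (fun A hA _ => ?_)
      ((hUm.mono hHK).indicator hS).aestronglyMeasurable
    obtain ⟨B, hB, hAB⟩ := htrace A hA
    rw [setIntegral_indicator_eq_of_inter_eq hS' hAB, setIntegral_indicator_eq_of_inter_eq hS' hAB,
      ← setIntegral_condExp hH (hUi.indicator hS') hB,
      ← setIntegral_condExp hH (hVZ.indicator hS') hB, hUS, hVSZ]
    refine setIntegral_congr_ae (hH _ hB) ?_
    filter_upwards [hpullU, hpullV] with ω h1 h2 _
    rw [h1, h2, mul_comm]
  have hSVZ : S.indicator (V * Z) = S.indicator V * Z := by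
    ext ω; by_cases h : ω ∈ S <;> simp [h]
  have hpullK : μ[S.indicator (V * Z) | K] =ᵐ[μ] S.indicator V * μ[Z | K] := by
    rw [hSVZ]
    exact condExp_mul_of_stronglyMeasurable_left ((hVm.mono hHK).indicator hS)
      (hSVZ ▸ hVZ.indicator hS') hZ
  filter_upwards [hUV, hpullK, hpos] with ω h1 h2 h3 hω
  rw [h2] at h1
  simp only [Pi.mul_apply, Set.indicator_of_mem hω] at h1
  rw [eq_div_iff (h3 hω).ne', h1, mul_comm]

/-- Tower property for a variable whose `G`-conditional expectation is a linear combination. -/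
lemma condExp_eq_sum_of_le {ι : Type*} [Fintype ι] [IsFiniteMeasure μ] (hHK : H ≤ K)
    (hK : K ≤ mΩ) {f : Ω → ℝ} (c : ι → ℝ) {g : ι → Ω → ℝ} (hg : ∀ i, Integrable (g i) μ)
    (hf : μ[f | K] =ᵐ[μ] fun ω => ∑ i, c i * g i ω) :
    μ[f | H] =ᵐ[μ] fun ω => ∑ i, c i * (μ[g i | H]) ω := by
  have hsum : (fun ω => ∑ i, c i * g i ω) = ∑ i, c i • g i := by
    ext ω; simp
  have h1 : ∀ᵐ ω ∂μ, ∀ i, (μ[c i • g i | H]) ω = c i * (μ[g i | H]) ω :=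
    ae_all_iff.2 fun i => by
      filter_upwards [condExp_smul (μ := μ) (c i) (g i) H] with ω h using h
  rw [hsum] at hf
  filter_upwards [condExp_condExp_of_le (μ := μ) (f := f) hHK hK, condExp_congr_ae (m := H) hf,
    condExp_finsetSum (s := Finset.univ) (fun i _ => (hg i).smul (c i)) H, h1] with ω a b d e
  rw [← a, b, d, Finset.sum_apply]
  exact Finset.sum_congr rfl fun i _ => e i

end Bayes

section History

variable {Ω : Type*}

/-- The σ-algebra generated by `Y_0, …, Y_{t-1}`, trivial for `t = 0`. -/
def sigmaBefore {α : Type*} [MeasurableSpace α] (Y : ℕ → Ω → α) : ℕ → MeasurableSpace Ω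
  | 0 => ⊥
  | t + 1 => sigmaUpTo Y t

lemma sigmaUpTo_eq_sup {α : Type*} [MeasurableSpace α] (Y : ℕ → Ω → α) (t : ℕ) :
    sigmaUpTo Y t = sigmaBefore Y t ⊔ MeasurableSpace.comap (Y t) inferInstance := by
  cases t with
  | zero => simp [sigmaBefore, sigmaUpTo]
  | succ t =>
    simp [sigmaBefore, sigmaUpTo, Nat.le_succ_iff, iSup_or, iSup_sup_eq]

lemma filtG_eq_sup {n m : ℕ} (X : ℕ → Ω → Fin n → ℝ) (Y : ℕ → Ω → Fin m → ℝ) (t : ℕ) :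
    filtG X Y t = sigmaUpTo X t ⊔ sigmaBefore Y t := by
  cases t <;> simp [filtG, sigmaBefore]

lemma sigmaUpTo_le {α : Type*} [MeasurableSpace α] {mΩ : MeasurableSpace Ω} {Y : ℕ → Ω → α}
    (hY : ∀ t, Measurable (Y t)) (t : ℕ) : sigmaUpTo Y t ≤ mΩ :=
  iSup₂_le fun s _ => (hY s).comap_le

lemma filtG_le {n m : ℕ} {mΩ : MeasurableSpace Ω} {X : ℕ → Ω → Fin n → ℝ}
    {Y : ℕ → Ω → Fin m → ℝ} (hX : ∀ t, Measurable (X t)) (hY : ∀ t, Measurable (Y t)) (t : ℕ) :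
    filtG X Y t ≤ mΩ := by
  cases t with
  | zero => exact sigmaUpTo_le hX 0
  | succ t => exact sup_le (sigmaUpTo_le hX _) (sigmaUpTo_le hY t)

lemma measurable_filtG {n m : ℕ} (X : ℕ → Ω → Fin n → ℝ) (Y : ℕ → Ω → Fin m → ℝ) (t : ℕ) :
    Measurable[filtG X Y t] (X t) := by
  rw [filtG_eq_sup, sigmaUpTo_eq_sup]
  exact (comap_measurable (X t)).mono (le_sup_right.trans le_sup_left) le_rfl

lemma predictor_eq_condExp {n m : ℕ} {mΩ : MeasurableSpace Ω} (μ : Measure Ω)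
    [IsProbabilityMeasure μ] (X : ℕ → Ω → Fin n → ℝ) (Y : ℕ → Ω → Fin m → ℝ) (t : ℕ) (k : Fin n) :
    μ[fun ω => X t ω k | sigmaBefore Y t] = fun ω => predictor μ X Y t ω k := by
  cases t with
  | zero => simp [sigmaBefore, predictor, condExp_bot]
  | succ t => rfl

end History

lemma stdBasis_injective (n : ℕ) : Function.Injective (stdBasis n) := fun i j h => by
  by_contra hij
  simpa [_root_.stdBasis, hij] using congrFun h i

lemma sum_stdBasis {n : ℕ} (i : Fin n) : ∑ k, stdBasis n i k = 1 := by
  simp [_root_.stdBasis]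

lemma idKronOnesRow_mul_apply {m n : ℕ} (R : Matrix (Fin m × Fin n) (Fin n) ℝ) (j : Fin m)
    (i : Fin n) : (idKronOnesRow m n * R) j i = ∑ a, R (j, a) i := by
  simp only [idKronOnesRow, Matrix.mul_apply, Fintype.sum_prod_type, Matrix.one_apply,
    Matrix.submatrix_apply, Matrix.kroneckerMap_apply, Matrix.of_apply, id_eq, mul_one, ite_mul,
    one_mul, zero_mul]
  rw [Finset.sum_comm]
  simp

lemma sum_block_mulVec {m n : ℕ} (R : Matrix (Fin m × Fin n) (Fin n) ℝ) (j : Fin m)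
    (x : Fin n → ℝ) :
    ∑ a, (block R j).mulVec x a = (idKronOnesRow m n * R).mulVec x j := by
  simp only [Matrix.mulVec, dotProduct, idKronOnesRow_mul_apply, Finset.sum_mul, block,
    Matrix.of_apply]
  exact Finset.sum_comm

/-- **filter for `Σ_S`.** Suppose `E[W_{t+1} | 𝓖_t] = R̄ X_t` a.s. for all
`t ≥ 0`, where `W_{t+1} = Y_t ⊗ X_{t+1}`, `𝓖_0 = σ(X_0)`, and `R̄` has blocks `R_1, …, R_m`.
With the predictor `X̂_{t+1|t} = E[X_{t+1} | 𝓕^Y_t]` (and `X̂_{0|-1} = E[X_0]`), the filter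
`X̂_t = E[X_t | 𝓕^Y_t]` and `G = (I_m ⊗ 1_n^T) R̄`: (i) a.s. on `{Y_t = f_j}` one has
`1_n^T R_j X̂_{t|t-1} > 0` and `X̂_{t+1|t} = R_j X̂_{t|t-1} / (1_n^T R_j X̂_{t|t-1})`;
(ii) `E[Y_{t+1} | 𝓕^Y_t] = G X̂_{t+1|t}` a.s.; (iii) a.s. on `{Y_{t+1} = f_j}` one has
`(G X̂_{t+1|t})_j > 0` and `X̂_{t+1} = diag(X̂_{t+1|t}) G_{j·}^T / (G X̂_{t+1|t})_j`. -/
theorem filter_sigmaS {Ω : Type*} {mΩ : MeasurableSpace Ω} {n m : ℕ}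
    (μ : Measure Ω) [IsProbabilityMeasure μ]
    (X : ℕ → Ω → Fin n → ℝ) (Y : ℕ → Ω → Fin m → ℝ)
    (hXmeas : ∀ t, Measurable (X t)) (hYmeas : ∀ t, Measurable (Y t))
    (hXval : ∀ t ω, ∃ i, X t ω = stdBasis n i)
    (hYval : ∀ t ω, ∃ j, Y t ω = stdBasis m j)
    (Rbar : Matrix (Fin m × Fin n) (Fin n) ℝ)
    -- `W` is `𝓖`-Markov with one-step conditional expectations `R̄ X_t`:
    (hW : ∀ t, ∀ᵐ ω ∂μ, ∀ p : Fin m × Fin n,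
      (μ[fun ω' => vecKron (Y t ω') (X (t + 1) ω') p | filtG X Y t]) ω
        = Rbar.mulVec (X t ω) p) :
    -- (i) the recursive predictor:
    (∀ (t : ℕ) (j : Fin m), ∀ᵐ ω ∂μ, Y t ω = stdBasis m j →
      (0 < ∑ a, (block Rbar j).mulVec (predictor μ X Y t ω) a)
      ∧ (∀ k, predictor μ X Y (t + 1) ω k
          = (block Rbar j).mulVec (predictor μ X Y t ω) k
            / ∑ a, (block Rbar j).mulVec (predictor μ X Y t ω) a))
    ∧
    -- (ii) the prediction of the output, with `G = (I_m ⊗ 1_n^T) R̄`: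
    (∀ t : ℕ, ∀ᵐ ω ∂μ, ∀ j' : Fin m,
      (μ[fun ω' => Y (t + 1) ω' j' | sigmaUpTo Y t]) ω
        = (idKronOnesRow m n * Rbar).mulVec (predictor μ X Y (t + 1) ω) j')
    ∧
    -- (iii) the filter in terms of the predictor:
    (∀ (t : ℕ) (j : Fin m), ∀ᵐ ω ∂μ, Y (t + 1) ω = stdBasis m j →
      (0 < (idKronOnesRow m n * Rbar).mulVec (predictor μ X Y (t + 1) ω) j)
      ∧ (∀ k, (μ[fun ω' => X (t + 1) ω' k | sigmaUpTo Y (t + 1)]) ω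
          = predictor μ X Y (t + 1) ω k * (idKronOnesRow m n * Rbar) j k
            / (idKronOnesRow m n * Rbar).mulVec (predictor μ X Y (t + 1) ω) j)) := by
  set G := idKronOnesRow m n * Rbar with hG
  let S : ℕ → Fin m → Set Ω := fun t j => {ω | Y t ω = stdBasis m j}
  have hHle : ∀ t, sigmaBefore Y t ≤ sigmaUpTo Y t := fun t => by
    rw [sigmaUpTo_eq_sup]; exact le_sup_left
  have hHG : ∀ t, sigmaBefore Y t ≤ filtG X Y t := fun t => by
    rw [filtG_eq_sup]; exact le_sup_right
  have hGle := filtG_le hXmeas hYmeas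
  have hKle := sigmaUpTo_le hYmeas
  have hSK : ∀ t j, MeasurableSet[sigmaUpTo Y t] (S t j) := fun t j => by
    rw [sigmaUpTo_eq_sup]
    exact (le_sup_right : _ ≤ sigmaBefore Y t ⊔ MeasurableSpace.comap (Y t) inferInstance) _
      ⟨{stdBasis m j}, measurableSet_singleton _, rfl⟩
  have hSm : ∀ t j, MeasurableSet (S t j) := fun t j => hKle t _ (hSK t j)
  have htrace : ∀ t j A, MeasurableSet[sigmaUpTo Y t] A →
      ∃ B, MeasurableSet[sigmaBefore Y t] B ∧ A ∩ S t j = B ∩ S t j := fun t j A hA => by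
    rw [sigmaUpTo_eq_sup] at hA
    exact exists_measurableSet_inter_level_eq (Y t) (stdBasis m j) hA
  have hXint : ∀ t k, Integrable (fun ω => X t ω k) μ := fun t k => by
    refine Integrable.of_bound ((measurable_pi_apply k).comp (hXmeas t)).aestronglyMeasurable 1
      (Filter.Eventually.of_forall fun ω => ?_)
    obtain ⟨i, hi⟩ := hXval t ω
    by_cases h : k = i <;> simp [hi, _root_.stdBasis, h]
  have hXone : ∀ t ω, ∑ k, X t ω k = 1 := fun t ω => by
    obtain ⟨i, hi⟩ := hXval t ω
    rw [hi, sum_stdBasis]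
  have hYind : ∀ t ω j, Y t ω j = (S t j).indicator (fun _ => (1 : ℝ)) ω := fun t ω j => by
    obtain ⟨i, hi⟩ := hYval t ω
    by_cases h : j = i
    · subst h
      simp [S, hi, _root_.stdBasis]
    · have : ¬ i = j := fun h' => h h'.symm
      simp [S, hi, _root_.stdBasis, h, (stdBasis_injective m).eq_iff, this]
  have hind : ∀ t j (f : Ω → ℝ), (S t j).indicator f = fun ω => Y t ω j * f ω := fun t j f => by
    ext ω
    by_cases h : ω ∈ S t j <;> simp [hYind, h]
  -- joint law of `Y_t` and `X_{t+1}` given the observations before `t`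
  have hWG : ∀ t j k, μ[(S t j).indicator (fun ω => X (t + 1) ω k) | filtG X Y t]
      =ᵐ[μ] fun ω => ∑ i, Rbar (j, k) i * X t ω i := fun t j k => by
    rw [hind]
    filter_upwards [hW t] with ω hω using hω (j, k)
  have hone : ∀ t j, (S t j).indicator (fun _ => (1 : ℝ))
      = ∑ k, (S t j).indicator (fun ω => X (t + 1) ω k) := fun t j => by
    ext ω
    by_cases h : ω ∈ S t j <;> simp [h, hXone]
  have hSG : ∀ t j, μ[(S t j).indicator (fun _ => (1 : ℝ)) | filtG X Y t]
      =ᵐ[μ] fun ω => ∑ i, G j i * X t ω i := fun t j => by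
    rw [hone]
    filter_upwards [condExp_finsetSum (μ := μ) (s := Finset.univ)
      (fun k _ => (hXint (t + 1) k).indicator (hSm t j)) (filtG X Y t),
      ae_all_iff.2 (hWG t j)] with ω h1 h2
    rw [h1, Finset.sum_apply, Finset.sum_congr rfl fun k _ => h2 k, Finset.sum_comm]
    simp only [hG, idKronOnesRow_mul_apply, Finset.sum_mul]
  have hWH : ∀ t j k, μ[(S t j).indicator (fun ω => X (t + 1) ω k) | sigmaBefore Y t]
      =ᵐ[μ] fun ω => (block Rbar j).mulVec (predictor μ X Y t ω) k := fun t j k => by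
    have h := condExp_eq_sum_of_le (hHG t) (hGle t) _ (hXint t) (hWG t j k)
    simp only [predictor_eq_condExp] at h
    exact h
  have hSH : ∀ t j, μ[(S t j).indicator (fun _ => (1 : ℝ)) | sigmaBefore Y t]
      =ᵐ[μ] fun ω => G.mulVec (predictor μ X Y t ω) j := fun t j => by
    have h := condExp_eq_sum_of_le (hHG t) (hGle t) _ (hXint t) (hSG t j)
    simp only [predictor_eq_condExp] at h
    exact h
  -- joint law of `Y_t` and `X_t` given the observations before `t`
  have hXG : ∀ t j k, μ[(S t j).indicator (fun ω => X t ω k) | filtG X Y t]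
      =ᵐ[μ] fun ω => ∑ _i : Unit, G j k * X t ω k := fun t j k => by
    have hmul : (S t j).indicator (fun ω => X t ω k)
        = (fun ω => X t ω k) * (S t j).indicator (fun _ => (1 : ℝ)) := by
      ext ω
      by_cases h : ω ∈ S t j <;> simp [h]
    have hm : StronglyMeasurable[filtG X Y t] fun ω => X t ω k :=
      ((measurable_pi_apply k).comp (measurable_filtG X Y t)).stronglyMeasurable
    have hi := (hXint t k).indicator (hSm t j)
    rw [hmul] at hi ⊢
    filter_upwards [condExp_mul_of_stronglyMeasurable_left hm hi
      ((integrable_const (1 : ℝ)).indicator (hSm t j)), hSG t j] with ω h1 h2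
    rw [h1, Pi.mul_apply, h2]
    obtain ⟨i, hi⟩ := hXval t ω
    by_cases h : k = i <;> simp [hi, _root_.stdBasis, h]
  have hXH : ∀ t j k, μ[(S t j).indicator (fun ω => X t ω k) | sigmaBefore Y t]
      =ᵐ[μ] fun ω => G j k * predictor μ X Y t ω k := fun t j k => by
    have h := condExp_eq_sum_of_le (hHG t) (hGle t) _ (fun _ => hXint t k) (hXG t j k)
    simpa [predictor_eq_condExp] using h
  have hpos : ∀ t j, ∀ᵐ ω ∂μ, Y t ω = stdBasis m j →
      0 < G.mulVec (predictor μ X Y t ω) j := fun t j => by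
    filter_upwards [ae_condExp_indicator_one_pos ((hHle t).trans (hKle t)) (hSm t j), hSH t j]
      with ω h1 h2 hω
    exact h2 ▸ h1 hω
  have hbayes := fun t j {Z : Ω → ℝ} (hZ : Integrable Z μ) =>
    ae_condExp_eq_div_of_trace_eq (hHle t) (hKle t) (hSK t j) (htrace t j) hZ
  refine ⟨fun t j => ?_, fun t => ?_, fun t j => ?_⟩
  · filter_upwards [hpos t j, hSH t j, ae_all_iff.2 (hWH t j),
      ae_all_iff.2 fun k => hbayes t j (hXint (t + 1) k)] with ω h1 h2 h3 h4 hω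
    rw [sum_block_mulVec]
    refine ⟨h1 hω, fun k => ?_⟩
    rw [← h2, ← h3 k]
    exact h4 k hω
  · refine ae_all_iff.2 fun j => ?_
    simp only [hYind]
    exact hSH (t + 1) j
  · filter_upwards [hpos (t + 1) j, hSH (t + 1) j, ae_all_iff.2 (hXH (t + 1) j),
      ae_all_iff.2 fun k => hbayes (t + 1) j (hXint (t + 1) k)] with ω h1 h2 h3 h4 hω
    refine ⟨h1 hω, fun k => ?_⟩
    rw [← h2, mul_comm, ← h3 k]
    exact h4 k hω
end
end
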